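/- The four vectors |S_1⟩ = |0⟩⊗|0⟩⊗|0⟩, |S_2⟩ = |1⟩⊗|−⟩⊗|+⟩, |S_3⟩ = |+⟩⊗|1⟩⊗|−⟩, |S_4⟩ = |−⟩⊗|+⟩⊗|1⟩, where |±⟩ = (|0⟩±|1⟩)/√2, form a three-qubit unextendible product basis: they are mutually orthogonal product vectors in ℂ²⊗ℂ²⊗ℂ², and the orthogonal complement of their span contains no nonzero product vector. -/

import Mathlib

noncomputable section

open Matrix Finset
open scoped ComplexOrder

/-- one-qubit vectors -/
abbrev V2 := Fin 2 → ℂ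
/-- index set of the three-qubit space ℂ²⊗ℂ²⊗ℂ² -/
abbrev I8 := Fin 2 × Fin 2 × Fin 2
/-- three-qubit vectors -/
abbrev V8 := I8 → ℂ
/-- one-qubit operators -/
abbrev M2 := Matrix (Fin 2) (Fin 2) ℂ
/-- three-qubit operators -/
abbrev M8 := Matrix I8 I8 ℂ

/-- inner product on ℂ², conjugate-linear in the first argument -/
def inner2 (u v : V2) : ℂ := ∑ i, star (u i) * v i

/-- inner product on ℂ²⊗ℂ²⊗ℂ², conjugate-linear in the first argument -/
def inner8 (u v : V8) : ℂ := ∑ p, star (u p) * v p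

/-- tensor product |a⟩⊗|b⟩⊗|c⟩ of three one-qubit vectors -/
def tp3 (a b c : V2) : V8 := fun p => a p.1 * b p.2.1 * c p.2.2

/-- Kronecker (tensor) product X_A⊗X_B⊗X_C of three one-qubit operators -/
def kron3 (X Y Z : M2) : M8 :=
  Matrix.of fun p q => X p.1 q.1 * Y p.2.1 q.2.1 * Z p.2.2 q.2.2

/-- a product operator on three qubits -/
def IsProductOp (X : M8) : Prop := ∃ XA XB XC : M2, X = kron3 XA XB XC

/-- the projector |v⟩⟨v| onto a vector -/
def proj8 (v : V8) : M8 := Matrix.vecMulVec v (star v)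

/-- A three-qubit unextendible product basis with `n` members: mutually orthonormal
product vectors (products of unit vectors) such that the orthogonal complement of
their span contains no nonzero product vector. -/
structure UPB (n : ℕ) where
  S : Fin n → V8
  prod : ∀ j, ∃ a b c : V2,
    inner2 a a = 1 ∧ inner2 b b = 1 ∧ inner2 c c = 1 ∧ S j = tp3 a b c
  ortho : ∀ i j, inner8 (S i) (S j) = if i = j then 1 else 0
  unext : ∀ a b c : V2, (∀ j, inner8 (S j) (tp3 a b c) = 0) → tp3 a b c = 0

/-- the bound entangled state ρ_S = (1/(8-n))(I - Σ_j |S_j⟩⟨S_j|) associated with a UPB -/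
def upbState {n : ℕ} (U : UPB n) : M8 :=
  ((8 : ℂ) - (n : ℂ))⁻¹ • ((1 : M8) - ∑ j, proj8 (U.S j))

/-- equivalence of four-member UPBs: related by local unitaries and a permutation of members -/
def UPB.Equiv (S T : UPB 4) : Prop :=
  ∃ UA UB UC : M2, UA ∈ Matrix.unitaryGroup (Fin 2) ℂ ∧
    UB ∈ Matrix.unitaryGroup (Fin 2) ℂ ∧ UC ∈ Matrix.unitaryGroup (Fin 2) ℂ ∧
    ∃ σ : Equiv.Perm (Fin 4), ∀ j, S.S j = (kron3 UA UB UC).mulVec (T.S (σ j))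

/-- The positive semidefinite square root of a positive semidefinite matrix
(the former Mathlib definition, since removed) -/
def Matrix.PosSemidef.sqrt {n 𝕜 : Type*} [Fintype n] [RCLike 𝕜] [DecidableEq n]
    {A : Matrix n n 𝕜} (hA : A.PosSemidef) : Matrix n n 𝕜 :=
  hA.1.eigenvectorUnitary.1 * diagonal ((↑) ∘ Real.sqrt ∘ hA.1.eigenvalues) *
  (star hA.1.eigenvectorUnitary : Matrix n n 𝕜)

/-- square root of a positive semidefinite matrix (junk value 0 otherwise) -/
def msqrt {m : Type*} [Fintype m] [DecidableEq m] (A : Matrix m m ℂ) : Matrix m m ℂ :=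
  open scoped Classical in if h : A.PosSemidef then h.sqrt else 0

/-- fidelity F(ρ,σ) = tr √(√ρ σ √ρ) of positive semidefinite matrices -/
def fidelity {m : Type*} [Fintype m] [DecidableEq m] (ρ σ : Matrix m m ℂ) : ℝ :=
  ((msqrt (msqrt ρ * σ * msqrt ρ)).trace).re

/-- standard basis vector |0⟩ of ℂ² -/
def e0 : V2 := ![1, 0]
/-- standard basis vector |1⟩ of ℂ² -/
def e1 : V2 := ![0, 1]
/-- the state |+⟩ = (|0⟩+|1⟩)/√2 -/
def vplus : V2 := ![((1 / Real.sqrt 2 : ℝ) : ℂ), ((1 / Real.sqrt 2 : ℝ) : ℂ)]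
/-- the state |−⟩ = (|0⟩−|1⟩)/√2 -/
def vminus : V2 := ![((1 / Real.sqrt 2 : ℝ) : ℂ), ((-(1 / Real.sqrt 2) : ℝ) : ℂ)]

theorem inner8_tp3 (a b c a' b' c' : V2) :
    inner8 (tp3 a b c) (tp3 a' b' c') = inner2 a a' * inner2 b b' * inner2 c c' := by
  simp only [inner8, inner2, tp3, Fintype.sum_prod_type, Fin.sum_univ_two, star_mul']
  ring

theorem tp3_eq_zero {a b c : V2} (h : a = 0 ∨ b = 0 ∨ c = 0) : tp3 a b c = 0 := by
  ext p
  rcases h with rfl | rfl | rfl <;> simp [tp3]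

theorem inner2_e0 (w : V2) : inner2 e0 w = w 0 := by
  simp [inner2, e0]

theorem inner2_e1 (w : V2) : inner2 e1 w = w 1 := by
  simp [inner2, e1]

theorem inner2_vplus (w : V2) :
    inner2 vplus w = ((1 / Real.sqrt 2 : ℝ) : ℂ) * (w 0 + w 1) := by
  simp [inner2, vplus, mul_add]

theorem inner2_vminus (w : V2) :
    inner2 vminus w = ((1 / Real.sqrt 2 : ℝ) : ℂ) * (w 0 - w 1) := by
  simp [inner2, vminus, mul_sub, ← sub_eq_add_neg]

theorem inv_sqrt_two_mul_self :
    ((1 / Real.sqrt 2 : ℝ) : ℂ) * ((1 / Real.sqrt 2 : ℝ) : ℂ) = 1 / 2 := by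
  rw [← Complex.ofReal_mul, div_mul_div_comm, Real.mul_self_sqrt (by norm_num)]
  norm_num

theorem inv_sqrt_two_ne_zero : ((1 / Real.sqrt 2 : ℝ) : ℂ) ≠ 0 := by
  simp

theorem inner2_vplus_vplus : inner2 vplus vplus = 1 := by
  rw [inner2_vplus]
  simp only [vplus, cons_val_zero, cons_val_one, mul_add, inv_sqrt_two_mul_self]
  norm_num

theorem inner2_vminus_vminus : inner2 vminus vminus = 1 := by
  rw [inner2_vminus]
  simp only [vminus, cons_val_zero, cons_val_one, Complex.ofReal_neg, mul_sub, mul_neg,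
    inv_sqrt_two_mul_self]
  norm_num

theorem inner2_vplus_vminus : inner2 vplus vminus = 0 := by
  simp [inner2_vplus, vminus]

theorem inner2_vminus_vplus : inner2 vminus vplus = 0 := by
  simp [inner2_vminus, vplus]

/-- the "Shifts" family |000⟩, |1,−,+⟩, |+,1,−⟩, |−,+,1⟩ is a
three-qubit unextendible product basis. -/
theorem stmt15 :
    ∀ Sv : Fin 4 → V8,
      Sv = ![tp3 e0 e0 e0, tp3 e1 vminus vplus, tp3 vplus e1 vminus, tp3 vminus vplus e1] →
      (∀ i j, inner8 (Sv i) (Sv j) = if i = j then 1 else 0) ∧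
      (∀ a b c : V2, (∀ j, inner8 (Sv j) (tp3 a b c) = 0) → tp3 a b c = 0) := by
  rintro _ rfl
  constructor
  · have h00 : inner2 e0 e0 = 1 := by rw [inner2_e0]; simp [e0]
    have h01 : inner2 e0 e1 = 0 := by simp [inner2_e0, e1]
    have h10 : inner2 e1 e0 = 0 := by simp [inner2_e1, e0]
    have h11 : inner2 e1 e1 = 1 := by rw [inner2_e1]; simp [e1]
    intro i j
    fin_cases i <;> fin_cases j <;>
      simp [inner8_tp3, h00, h01, h10, h11, inner2_vplus_vplus, inner2_vminus_vminus,
        inner2_vplus_vminus, inner2_vminus_vplus]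
  · intro a b c h
    apply tp3_eq_zero
    have eq_zero_iff (w : V2) : w = 0 ↔ w 0 = 0 ∧ w 1 = 0 := by
      simp [funext_iff, Fin.forall_fin_two]
    simp only [eq_zero_iff]
    simp only [Fin.forall_fin_succ, IsEmpty.forall_iff, cons_val_zero, cons_val_succ,
      inner8_tp3, inner2_e0, inner2_e1, inner2_vplus, inner2_vminus, mul_eq_zero,
      inv_sqrt_two_ne_zero, false_or, and_true] at h
    obtain ⟨h0, h1, h2, h3⟩ := h
    rcases h0 with (h0 | h0) | h0 <;> rcases h1 with (h1 | h1) | h1 <;>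
      rcases h2 with (h2 | h2) | h2 <;> rcases h3 with (h3 | h3) | h3 <;> grind
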